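/- Let k ≥ 0 and let y satisfy 2^k ≤ y < 2^{k+1}. For (x,z) ∈ ℕ×ℕ write x̃ = x mod 2^{k+1} and z̃ = z mod 2^{k+1}. If y is not a Zumkeller number and (x,z) ∈ Ulam[y], then 2^{k+1}−1 ≤ x̃+z̃ ≤ 2^{k+2}−y−2. If y is a Zumkeller number, (x,z) ∈ Ulam[y], and x+z ∉ {y, y+1, y+2}, then the same inequalities 2^{k+1}−1 ≤ x̃+z̃ ≤ 2^{k+2}−y−2 hold. -/

import Mathlib

/-- Fuel-indexed Ulam predicate: a binary word (as a `List Bool`) of length 1 is Ulam,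
and a longer word is Ulam iff it is expressible *uniquely* as a concatenation of two
distinct (nonempty) Ulam words. The fuel strictly exceeds the lengths needed. -/
def ulamAux : ℕ → List Bool → Prop
  | 0, _ => False
  | n + 1, w =>
    if w.length = 1 then True
    else ∃! p : List Bool × List Bool,
      p.1 ≠ [] ∧ p.2 ≠ [] ∧ p.1 ≠ p.2 ∧ w = p.1 ++ p.2 ∧
        ulamAux n p.1 ∧ ulamAux n p.2

/-- A binary word is an Ulam word. -/
def IsUlam (w : List Bool) : Prop := ulamAux w.length w

/-- The word `0^x 1 0^y`. -/
def wordTwo (x y : ℕ) : List Bool :=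
  List.replicate x false ++ [true] ++ List.replicate y false

/-- The word `0^x 1 0^y 1 0^z`. -/
def wordThree (x y z : ℕ) : List Bool :=
  List.replicate x false ++ [true] ++ List.replicate y false ++ [true] ++
    List.replicate z false

/-- `UlamSet y` is the set of pairs `(x,z)` such that `0^x 1 0^y 1 0^z` is Ulam. -/
def UlamSet (y : ℕ) : Set (ℕ × ℕ) := {p | IsUlam (wordThree p.1 y p.2)}

/-- `culam y x z = min(2, N)` where `N` counts `0 ≤ a ≤ y` with both
`w(x,a)` and `w(y-a,z)` Ulam. -/
noncomputable def culam (y x z : ℕ) : ℕ :=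
  min 2 {a : ℕ | a ≤ y ∧ IsUlam (wordTwo x a) ∧ IsUlam (wordTwo (y - a) z)}.ncard

/-- A positive integer is Zumkeller if its binary representation has at most one `0`. -/
def IsZumkeller (y : ℕ) : Prop := 0 < y ∧ (Nat.bits y).count false ≤ 1

/-- The largest `e ≤ d - 1` with `x mod 2^(e+1) < 2^e` and `z mod 2^(e+1) < 2^e`
(and `0` if none exists). -/
def eIdx (d x z : ℕ) : ℕ :=
  Nat.findGreatest (fun e => x % 2 ^ (e + 1) < 2 ^ e ∧ z % 2 ^ (e + 1) < 2 ^ e) (d - 1)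

/-- The universal pattern `E1[d]` on `B_d`. -/
def E1 (d x z : ℕ) : ℕ :=
  if 2 ^ d - 1 ≤ x + z then 0
  else if x % 2 ^ eIdx d x z + z % 2 ^ eIdx d x z < 2 ^ eIdx d x z - 1 then 2 else 1

/-- The universal pattern `E2[d]` on `B_d` (constant `1`). -/
def E2 (_d _x _z : ℕ) : ℕ := 1

/-- The universal pattern `O1[d]` on `B_d`. -/
def O1 (d x z : ℕ) : ℕ :=
  if 2 ^ d - 2 ≤ x + z then 0
  else if (x + z) % 2 = 0 then (if x % 2 = 1 then 0 else 2)
  else if x % 2 ^ eIdx d x z + z % 2 ^ eIdx d x z < 2 ^ eIdx d x z - 1 then 2 else 1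

/-- The universal pattern `O2[d]` on `B_d` (independent of `d`). -/
def O2 (_d x z : ℕ) : ℕ :=
  if (x + z) % 2 = 0 then (if x % 2 = 1 then 0 else 2) else 1

theorem land_eq_zero_iff_half (m n : ℕ) :
    m &&& n = 0 ↔ ¬(m % 2 = 1 ∧ n % 2 = 1) ∧ m / 2 &&& n / 2 = 0 := by
  have h1 := Nat.and_mod_two_eq_one (a := m) (b := n)
  have h2 := Nat.and_div_two (a := m) (b := n)
  rw [← h1, ← h2]
  omega

theorem two_mul_land_eq_zero (m n : ℕ) : 2 * m &&& n = 0 ↔ m &&& n / 2 = 0 := by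
  rw [land_eq_zero_iff_half, show 2 * m / 2 = m by omega]
  simp

theorem two_mul_add_one_land_eq_zero (m n : ℕ) :
    (2 * m + 1) &&& n = 0 ↔ n % 2 = 0 ∧ m &&& n / 2 = 0 := by
  rw [land_eq_zero_iff_half, show (2 * m + 1) / 2 = m by omega]
  have : (2 * m + 1) % 2 = 1 := by omega
  have : n % 2 = 0 ∨ n % 2 = 1 := by omega
  simp [*]

/-- Pascal's rule modulo two for disjointness of binary expansions. -/
theorem land_eq_zero_iff_xor (x z : ℕ) (hx : 0 < x) (hz : 0 < z) :
    x &&& z = 0 ↔ ¬((x - 1) &&& z = 0 ↔ x &&& (z - 1) = 0) := by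
  induction x using Nat.strong_induction_on generalizing z with
  | _ x ih =>
    rcases Nat.even_or_odd' x with ⟨u, rfl | rfl⟩ <;>
      rcases Nat.even_or_odd' z with ⟨v, rfl | rfl⟩
    · obtain ⟨u, rfl⟩ : ∃ w, u = w + 1 := ⟨u - 1, by omega⟩
      obtain ⟨v, rfl⟩ : ∃ w, v = w + 1 := ⟨v - 1, by omega⟩
      have := ih (u + 1) (by omega) (v + 1) (by omega) (by omega)
      rw [show 2 * (u + 1) - 1 = 2 * u + 1 by omega, show 2 * (v + 1) - 1 = 2 * v + 1 by omega,
        two_mul_land_eq_zero, two_mul_add_one_land_eq_zero, two_mul_land_eq_zero,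
        show 2 * (v + 1) / 2 = v + 1 by omega, show (2 * v + 1) / 2 = v by omega]
      simpa using this
    · obtain ⟨u, rfl⟩ : ∃ w, u = w + 1 := ⟨u - 1, by omega⟩
      rw [show 2 * (u + 1) - 1 = 2 * u + 1 by omega, show 2 * v + 1 - 1 = 2 * v by omega,
        two_mul_land_eq_zero, two_mul_add_one_land_eq_zero, two_mul_land_eq_zero,
        show 2 * v / 2 = v by omega, show (2 * v + 1) / 2 = v by omega]
      have : (2 * v + 1) % 2 = 1 := by omega
      simp [this]
    · obtain ⟨v, rfl⟩ : ∃ w, v = w + 1 := ⟨v - 1, by omega⟩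
      rw [show 2 * u + 1 - 1 = 2 * u by omega, show 2 * (v + 1) - 1 = 2 * v + 1 by omega,
        two_mul_add_one_land_eq_zero, two_mul_land_eq_zero, two_mul_add_one_land_eq_zero]
      have : (2 * v + 1) % 2 = 1 := by omega
      simp [this]
    · rw [show 2 * u + 1 - 1 = 2 * u by omega, show 2 * v + 1 - 1 = 2 * v by omega,
        two_mul_add_one_land_eq_zero, two_mul_land_eq_zero, two_mul_add_one_land_eq_zero,
        show (2 * v + 1) / 2 = v by omega, show 2 * v / 2 = v by omega]
      have : (2 * v + 1) % 2 = 1 := by omega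
      simp [this]

theorem land_eq_zero_of_add_eq_two_pow_sub_one (n x z : ℕ) (h : x + z + 1 = 2 ^ n) :
    x &&& z = 0 := by
  induction n generalizing x z with
  | zero => simp [show x = 0 by simp at h; omega]
  | succ n ih =>
    rw [pow_succ] at h
    rw [land_eq_zero_iff_half]
    exact ⟨by omega, ih _ _ (by omega)⟩

theorem add_lt_two_pow_of_land_eq_zero (n x z : ℕ) (hx : x < 2 ^ n) (hz : z < 2 ^ n)
    (h : x &&& z = 0) : x + z < 2 ^ n := by
  induction n generalizing x z with
  | zero => simp at *; omega
  | succ n ih =>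
    rw [pow_succ] at *
    rw [land_eq_zero_iff_half] at h
    have := ih _ _ (by omega) (by omega) h.2
    omega

theorem land_mod_two_pow_eq_zero (n a x : ℕ) (ha : a < 2 ^ n) :
    a &&& x % 2 ^ n = 0 ↔ a &&& x = 0 := by
  have h := Nat.mod_eq_of_lt (lt_of_le_of_lt (Nat.and_le_left (n := a) (m := x)) ha)
  rw [Nat.and_mod_two_pow, Nat.mod_eq_of_lt ha] at h
  rw [h]

theorem sum_range_two_mul (n : ℕ) (f : ℕ → ℕ) :
    ∑ i ∈ Finset.range (2 * n), f i = ∑ i ∈ Finset.range n, (f (2 * i) + f (2 * i + 1)) := by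
  induction n with
  | zero => simp
  | succ n ih =>
    rw [show 2 * (n + 1) = 2 * n + 1 + 1 by ring, Finset.sum_range_succ, Finset.sum_range_succ, ih,
      Finset.sum_range_succ, add_assoc]

/-- The number of pairs `(a, b)` with `a + b = y` such that `a`, `x` have disjoint binary
expansions and so do `b`, `z`. -/
def disjCount (y x z : ℕ) : ℕ :=
  ∑ a ∈ Finset.range (y + 1), if a &&& x = 0 ∧ (y - a) &&& z = 0 then 1 else 0

theorem disjCount_zero (x z : ℕ) : disjCount 0 x z = 1 := by
  rw [disjCount, zero_add, Finset.sum_range_one]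
  simp

theorem disjCount_comm (y x z : ℕ) : disjCount y x z = disjCount y z x := by
  unfold disjCount
  rw [← Finset.sum_range_reflect]
  refine Finset.sum_congr rfl fun a ha => ?_
  rw [Finset.mem_range] at ha
  rw [show y + 1 - 1 - a = y - a by omega, show y - (y - a) = a by omega]
  simp only [and_comm]

theorem disjCount_two_mul_add_one (s x z : ℕ) :
    disjCount (2 * s + 1) x z = (if z % 2 = 0 then disjCount s (x / 2) (z / 2) else 0) +
      (if x % 2 = 0 then disjCount s (x / 2) (z / 2) else 0) := by
  unfold disjCount
  rw [show 2 * s + 1 + 1 = 2 * (s + 1) by ring, sum_range_two_mul, Finset.sum_add_distrib]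
  congr 1
  · split_ifs with hz
    · refine Finset.sum_congr rfl fun a ha => ?_
      rw [Finset.mem_range] at ha
      rw [show 2 * s + 1 - 2 * a = 2 * (s - a) + 1 by omega]
      simp [two_mul_land_eq_zero, two_mul_add_one_land_eq_zero, hz]
    · refine Finset.sum_eq_zero fun a ha => ?_
      rw [Finset.mem_range] at ha
      rw [show 2 * s + 1 - 2 * a = 2 * (s - a) + 1 by omega]
      simp [two_mul_add_one_land_eq_zero, hz]
  · split_ifs with hx
    · refine Finset.sum_congr rfl fun a ha => ?_
      rw [Finset.mem_range] at ha
      rw [show 2 * s + 1 - (2 * a + 1) = 2 * (s - a) by omega]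
      simp [two_mul_land_eq_zero, two_mul_add_one_land_eq_zero, hx]
    · refine Finset.sum_eq_zero fun a ha => ?_
      simp [two_mul_add_one_land_eq_zero, hx]

theorem disjCount_two_mul_add_two (s x z : ℕ) :
    disjCount (2 * s + 2) x z = disjCount (s + 1) (x / 2) (z / 2) +
      (if x % 2 = 0 ∧ z % 2 = 0 then disjCount s (x / 2) (z / 2) else 0) := by
  unfold disjCount
  rw [show 2 * s + 2 + 1 = 2 * (s + 1) + 1 by ring, Finset.sum_range_succ, sum_range_two_mul,
    Finset.sum_add_distrib, add_right_comm]
  congr 1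
  · rw [Finset.sum_range_succ _ (s + 1)]
    congr 1
    · refine Finset.sum_congr rfl fun a ha => ?_
      rw [Finset.mem_range] at ha
      rw [show 2 * s + 2 - 2 * a = 2 * (s + 1 - a) by omega]
      simp only [two_mul_land_eq_zero]
    · rw [show 2 * s + 2 = 2 * (s + 1) by ring]
      simp [two_mul_land_eq_zero]
  · split_ifs with hxz
    · refine Finset.sum_congr rfl fun a ha => ?_
      rw [Finset.mem_range] at ha
      rw [show 2 * s + 2 - (2 * a + 1) = 2 * (s - a) + 1 by omega]
      simp [two_mul_add_one_land_eq_zero, hxz.1, hxz.2]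
    · refine Finset.sum_eq_zero fun a ha => ?_
      rw [Finset.mem_range] at ha
      rw [show 2 * s + 2 - (2 * a + 1) = 2 * (s - a) + 1 by omega]
      simp only [two_mul_add_one_land_eq_zero]
      exact if_neg (by tauto)

theorem disjCount_mod (n y x z : ℕ) (hy : y < 2 ^ n) :
    disjCount y (x % 2 ^ n) (z % 2 ^ n) = disjCount y x z := by
  unfold disjCount
  refine Finset.sum_congr rfl fun a ha => ?_
  rw [Finset.mem_range] at ha
  simp only [land_mod_two_pow_eq_zero _ _ _ (show a < 2 ^ n by omega),
    land_mod_two_pow_eq_zero _ _ _ (show y - a < 2 ^ n by omega)]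

theorem disjCount_pos_iff (y x z : ℕ) :
    0 < disjCount y x z ↔ ∃ a b, a + b = y ∧ a &&& x = 0 ∧ b &&& z = 0 := by
  unfold disjCount
  rw [Finset.sum_pos_iff]
  constructor
  · rintro ⟨a, ha, h⟩
    rw [Finset.mem_range] at ha
    have : a &&& x = 0 ∧ (y - a) &&& z = 0 := by
      by_contra hc
      simp [hc] at h
    exact ⟨a, y - a, by omega, this⟩
  · rintro ⟨a, b, rfl, ha, hb⟩
    refine ⟨a, Finset.mem_range.2 (by omega), ?_⟩
    rw [if_pos ⟨ha, by rwa [Nat.add_sub_cancel_left]⟩]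
    exact one_pos

theorem disjCount_zero_left_pos (y z : ℕ) : 0 < disjCount y 0 z :=
  (disjCount_pos_iff _ _ _).2 ⟨y, 0, by simp, by simp, by simp⟩

theorem two_le_disjCount_zero_left (y z : ℕ) (hy : 0 < y) (hz : z % 2 = 0) :
    2 ≤ disjCount y 0 z := by
  rcases Nat.even_or_odd' y with ⟨s, rfl | rfl⟩
  · obtain ⟨s, rfl⟩ : ∃ t, s = t + 1 := ⟨s - 1, by omega⟩
    rw [mul_add, mul_one, disjCount_two_mul_add_two]
    have h1 := disjCount_zero_left_pos (s + 1) (z / 2)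
    have h2 := disjCount_zero_left_pos s (z / 2)
    simp only [hz, Nat.zero_mod, Nat.zero_div, and_self, if_true]
    omega
  · rw [disjCount_two_mul_add_one]
    have h2 := disjCount_zero_left_pos s (z / 2)
    simp only [hz, Nat.zero_mod, Nat.zero_div, if_true]
    omega

/-- The counts at `(y + 1, x + 1, z)`, `(y, x + 1, z)` and `(y + 1, x, z)` satisfy all three
triangle inequalities. -/
theorem disjCount_triangle (y x z : ℕ) :
    disjCount (y + 1) (x + 1) z ≤ disjCount y (x + 1) z + disjCount (y + 1) x z ∧
    disjCount y (x + 1) z ≤ disjCount (y + 1) (x + 1) z + disjCount (y + 1) x z ∧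
    disjCount (y + 1) x z ≤ disjCount (y + 1) (x + 1) z + disjCount y (x + 1) z := by
  induction y using Nat.strong_induction_on generalizing x z with
  | _ y ih =>
    have hz : z % 2 = 0 ∨ z % 2 = 1 := by omega
    rcases Nat.even_or_odd' x with ⟨u, rfl | rfl⟩ <;>
      rcases Nat.even_or_odd' y with ⟨s, rfl | rfl⟩
    · have e1 : (2 * u + 1) / 2 = u := by omega
      have e2 : 2 * u / 2 = u := by omega
      have e3 : (2 * u + 1) % 2 = 1 := by omega
      have e4 : 2 * u % 2 = 0 := by omega
      rcases s with _ | s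
      · have := disjCount_two_mul_add_one 0
        simp only [mul_zero, zero_add] at this ⊢
        rcases hz with hz | hz <;> simp [this, disjCount_zero, e3, hz]
      · rw [disjCount_two_mul_add_one, disjCount_two_mul_add_one, mul_add, mul_one,
          disjCount_two_mul_add_two, e1, e2, e3, e4]
        rcases hz with hz | hz <;> simp [hz]
    · have e1 : (2 * u + 1) / 2 = u := by omega
      have e2 : 2 * u / 2 = u := by omega
      have e3 : (2 * u + 1) % 2 = 1 := by omega
      have e4 : 2 * u % 2 = 0 := by omega
      rw [add_assoc (2 * s) 1 1, disjCount_two_mul_add_one, disjCount_two_mul_add_two,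
        disjCount_two_mul_add_two, e1, e2, e3, e4]
      rcases hz with hz | hz <;> simp [hz]
      omega
    · have e1 : (2 * u + 1 + 1) / 2 = u + 1 := by omega
      have e2 : (2 * u + 1) / 2 = u := by omega
      have e3 : (2 * u + 1 + 1) % 2 = 0 := by omega
      have e4 : (2 * u + 1) % 2 = 1 := by omega
      rcases s with _ | s
      · have := disjCount_two_mul_add_one 0
        simp only [mul_zero, zero_add] at this ⊢
        rcases hz with hz | hz <;> simp [this, disjCount_zero, e3, e4, hz]
      · have := ih s (by omega) u (z / 2)
        rw [disjCount_two_mul_add_one, disjCount_two_mul_add_one, mul_add, mul_one,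
          disjCount_two_mul_add_two, e1, e2, e3, e4]
        rcases hz with hz | hz <;> simp [hz]
        omega
    · have e1 : (2 * u + 1 + 1) / 2 = u + 1 := by omega
      have e2 : (2 * u + 1) / 2 = u := by omega
      have e3 : (2 * u + 1 + 1) % 2 = 0 := by omega
      have e4 : (2 * u + 1) % 2 = 1 := by omega
      have := ih s (by omega) u (z / 2)
      rw [add_assoc (2 * s) 1 1, disjCount_two_mul_add_one, disjCount_two_mul_add_two,
        disjCount_two_mul_add_two, e1, e2, e3, e4]
      rcases hz with hz | hz <;> simp [hz] <;> omega

theorem disjCount_neighbors_eq (y x z : ℕ) (h : disjCount y (x + 1) (z + 1) = 0) :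
    disjCount y x (z + 1) = disjCount y (x + 1) z := by
  rcases y with _ | y
  · simp [disjCount_zero] at h
  have h1 := disjCount_triangle y x (z + 1)
  have h2 := disjCount_triangle y z (x + 1)
  simp only [disjCount_comm _ _ (x + 1)] at h2
  omega

theorem disjCount_neighbor_eq_one (y x z : ℕ) (hy : 0 < y) (hp : (x + z) % 2 = 0)
    (h : disjCount y (x + 1) (z + 1) = 1) : disjCount y x (z + 1) = 1 := by
  rcases Nat.even_or_odd' y with ⟨s, rfl | rfl⟩
  · obtain ⟨s, rfl⟩ : ∃ t, s = t + 1 := ⟨s - 1, by omega⟩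
    rw [mul_add, mul_one, disjCount_two_mul_add_two] at h ⊢
    by_cases hx : x % 2 = 0
    · rw [if_neg (by omega)] at h ⊢
      rwa [show (x + 1) / 2 = x / 2 by omega] at h
    · have := disjCount_triangle s (x / 2) ((z + 1) / 2)
      rw [if_pos (by omega), show (x + 1) / 2 = x / 2 + 1 by omega] at h
      rw [if_neg (by omega)]
      omega
  · rw [disjCount_two_mul_add_one] at h
    split_ifs at h <;> omega

/-- A positive count bounds `x + z` from above. -/
theorem add_le_of_disjCount_pos (n y x z : ℕ) (hy : y < 2 ^ n) (hx : x < 2 ^ n) (hz : z < 2 ^ n)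
    (h : 0 < disjCount y x z) : x + z + y + 2 ≤ 2 * 2 ^ n := by
  obtain ⟨a, b, rfl, ha, hb⟩ := (disjCount_pos_iff _ _ _).1 h
  have h1 := add_lt_two_pow_of_land_eq_zero n a x (by omega) hx ha
  have h2 := add_lt_two_pow_of_land_eq_zero n b z (by omega) hz hb
  omega

/-- A count equal to one bounds `x + z` from below. -/
theorem two_pow_le_of_disjCount_eq_one (k y x z : ℕ) (h1 : 2 ^ k ≤ y) (h2 : y < 2 ^ (k + 1))
    (h : disjCount y x z = 1) : 2 ^ (k + 1) ≤ x + z + 1 := by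
  induction k generalizing y x z with
  | zero =>
    by_contra hc
    simp only [zero_add, pow_one, pow_zero] at *
    obtain rfl : y = 1 := by omega
    obtain rfl : x = 0 := by omega
    obtain rfl : z = 0 := by omega
    have := two_le_disjCount_zero_left 1 0
    omega
  | succ k ih =>
    have e1 : 2 ^ (k + 1) = 2 * 2 ^ k := by ring
    have e2 : 2 ^ (k + 1 + 1) = 2 * 2 ^ (k + 1) := by ring
    have hk : 0 < 2 ^ k := by positivity
    rcases Nat.even_or_odd' y with ⟨s, rfl | rfl⟩
    · obtain ⟨s, rfl⟩ : ∃ t, s = t + 1 := ⟨s - 1, by omega⟩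
      have hs := ih (s + 1)
      rw [mul_add, mul_one, disjCount_two_mul_add_two] at h
      by_cases hxz : x % 2 = 0 ∧ z % 2 = 0
      · rw [if_pos hxz] at h
        rcases Nat.eq_zero_or_pos (x / 2) with hx | hx
        · rcases Nat.eq_zero_or_pos (z / 2) with hz | hz
          · rw [hx, hz] at h
            have a1 := disjCount_zero_left_pos (s + 1) 0
            have a2 := disjCount_zero_left_pos s 0
            omega
          · have := disjCount_triangle s (z / 2 - 1) (x / 2)
            rw [Nat.sub_add_cancel hz] at this
            simp only [disjCount_comm _ _ (x / 2)] at this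
            have := hs (x / 2) (z / 2 - 1) (by omega) (by omega) (by omega)
            omega
        · have := disjCount_triangle s (x / 2 - 1) (z / 2)
          rw [Nat.sub_add_cancel hx] at this
          have := hs (x / 2 - 1) (z / 2) (by omega) (by omega) (by omega)
          omega
      · rw [if_neg hxz] at h
        have := hs _ _ (by omega) (by omega) h
        omega
    · rw [disjCount_two_mul_add_one] at h
      have := ih s (x / 2) (z / 2) (by omega) (by omega)
      split_ifs at h <;> omega

theorem count_false_bits_two_mul (n : ℕ) (hn : 0 < n) :
    (Nat.bits (2 * n)).count false = (Nat.bits n).count false + 1 := by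
  rw [Nat.bit0_bits _ hn.ne', List.count_cons_self]

theorem count_false_bits_two_mul_add_one (n : ℕ) :
    (Nat.bits (2 * n + 1)).count false = (Nat.bits n).count false := by
  rw [Nat.bit1_bits, List.count_cons_of_ne (by decide)]

theorem disjCount_of_land_eq_zero (y x z : ℕ) (h : x + z = y + 1) (hd : x &&& z = 0) :
    disjCount (y + 1) x z = 2 ^ (Nat.bits (y + 1)).count false ∧
      disjCount y x z = 2 ^ (Nat.bits (y + 1)).count false := by
  induction y using Nat.strong_induction_on generalizing x z with
  | _ y ih =>
    rw [land_eq_zero_iff_half] at hd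
    rcases Nat.even_or_odd' y with ⟨s, rfl | rfl⟩
    · rw [disjCount_two_mul_add_one, count_false_bits_two_mul_add_one]
      rcases s with _ | s
      · have : x % 2 = 0 ∧ z % 2 = 1 ∨ x % 2 = 1 ∧ z % 2 = 0 := by omega
        rcases this with ⟨h1, h2⟩ | ⟨h1, h2⟩ <;> simp [h1, h2, disjCount_zero]
      · rw [mul_add, mul_one, disjCount_two_mul_add_two]
        have := ih s (by omega) (x / 2) (z / 2) (by omega) hd.2
        rw [if_neg (by omega : ¬(x % 2 = 0 ∧ z % 2 = 0))]
        have : x % 2 = 0 ∧ z % 2 = 1 ∨ x % 2 = 1 ∧ z % 2 = 0 := by omega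
        rcases this with ⟨h1, h2⟩ | ⟨h1, h2⟩ <;> simp [h1, h2] <;> omega
    · have := ih s (by omega) (x / 2) (z / 2) (by omega) hd.2
      rw [show 2 * s + 1 + 1 = 2 * s + 2 by ring, disjCount_two_mul_add_two,
        disjCount_two_mul_add_one, if_pos (by omega), if_pos (by omega), if_pos (by omega),
        show 2 * s + 2 = 2 * (s + 1) by ring, count_false_bits_two_mul _ (by omega), pow_succ]
      omega

theorem ulamAux_congr_fuel (n m : ℕ) (w : List Bool) (hn : w.length ≤ n) (hm : w.length ≤ m) :
    ulamAux n w ↔ ulamAux m w := by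
  have nil_not (l : ℕ) : ¬ulamAux l [] := by
    rcases l with _ | l
    · simp [ulamAux]
    · rw [ulamAux, if_neg (by simp)]
      rintro ⟨p, ⟨h1, -, -, h2, -⟩, -⟩
      exact h1 (List.append_eq_nil_iff.1 h2.symm).1
  induction n generalizing m w with
  | zero =>
    obtain rfl : w = [] := List.eq_nil_of_length_eq_zero (by omega)
    simp [nil_not]
  | succ n ih =>
    rcases m with _ | m
    · obtain rfl : w = [] := List.eq_nil_of_length_eq_zero (by omega)
      simp [nil_not]
    · rw [ulamAux, ulamAux]
      split_ifs with h
      · rfl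
      · refine existsUnique_congr fun p => ?_
        refine and_congr_right fun h1 => and_congr_right fun h2 => and_congr_right fun _ =>
          and_congr_right fun h3 => ?_
        have h1 := List.length_pos_iff.2 h1
        have h2 := List.length_pos_iff.2 h2
        rw [h3, List.length_append] at hn hm
        exact and_congr (ih m p.1 (by omega) (by omega)) (ih m p.2 (by omega) (by omega))

theorem not_isUlam_nil : ¬IsUlam [] := by
  simp [IsUlam, ulamAux]

theorem isUlam_of_length_eq_one (w : List Bool) (h : w.length = 1) : IsUlam w := by
  rw [IsUlam, h, ulamAux, if_pos h]
  trivial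

theorem isUlam_iff_existsUnique (w : List Bool) (h : w.length ≠ 1) :
    IsUlam w ↔ ∃! p : List Bool × List Bool,
      p.1 ≠ [] ∧ p.2 ≠ [] ∧ p.1 ≠ p.2 ∧ w = p.1 ++ p.2 ∧ IsUlam p.1 ∧ IsUlam p.2 := by
  rw [IsUlam, ulamAux_congr_fuel _ (w.length + 1) w le_rfl (by omega), ulamAux, if_neg h]
  refine existsUnique_congr fun p => ?_
  refine and_congr_right fun _ => and_congr_right fun _ => and_congr_right fun _ =>
    and_congr_right fun h3 => ?_
  rw [IsUlam, IsUlam, ulamAux_congr_fuel _ p.1.length p.1 (by simp [h3]) le_rfl,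
    ulamAux_congr_fuel _ p.2.length p.2 (by simp [h3]) le_rfl]

open scoped Classical in
/-- The indicator of `(u, v)` being a pair of distinct Ulam words. -/
noncomputable def pairInd (u v : List Bool) : ℕ :=
  if IsUlam u ∧ IsUlam v ∧ u ≠ v then 1 else 0

/-- A word of length at least two is Ulam iff exactly one of its splittings is good. -/
theorem isUlam_iff_sum (w : List Bool) (n : ℕ) (h : w.length = n + 2) :
    IsUlam w ↔ ∑ i ∈ Finset.range (n + 1), pairInd (w.take (i + 1)) (w.drop (i + 1)) = 1 := by
  classical
  rw [isUlam_iff_existsUnique w (by omega)]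
  simp only [pairInd, Finset.sum_boole, Nat.cast_id, Finset.card_eq_one]
  constructor
  · rintro ⟨⟨u, v⟩, ⟨h1, h2, h3, h4, h5, h6⟩, huniq⟩
    simp only at h1 h2 h3 h4 h5 h6
    have h1 := List.length_pos_iff.2 h1
    have h2 := List.length_pos_iff.2 h2
    have hl : u.length + v.length = n + 2 := by rw [← h, h4, List.length_append]
    refine ⟨u.length - 1, ?_⟩
    ext i
    simp only [Finset.mem_filter, Finset.mem_range, Finset.mem_singleton]
    constructor
    · rintro ⟨hi, ha, hb, hc⟩
      have := huniq (w.take (i + 1), w.drop (i + 1))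
        ⟨fun h0 => not_isUlam_nil (h0 ▸ ha), fun h0 => not_isUlam_nil (h0 ▸ hb), hc,
          (List.take_append_drop _ _).symm, ha, hb⟩
      have := congrArg List.length (congrArg Prod.fst this)
      simp only [List.length_take] at this
      omega
    · rintro rfl
      rw [Nat.sub_add_cancel h1, h4, List.take_left, List.drop_left]
      exact ⟨by omega, h5, h6, h3⟩
  · rintro ⟨i, hi⟩
    have hmem : ∀ j, (j < n + 1 ∧ IsUlam (w.take (j + 1)) ∧ IsUlam (w.drop (j + 1)) ∧
        w.take (j + 1) ≠ w.drop (j + 1)) ↔ j = i := by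
      intro j
      rw [← Finset.mem_singleton, ← hi, Finset.mem_filter, Finset.mem_range]
    obtain ⟨h0, h1, h2, h3⟩ := (hmem i).2 rfl
    refine ⟨(w.take (i + 1), w.drop (i + 1)),
      ⟨fun h0 => not_isUlam_nil (h0 ▸ h1), fun h0 => not_isUlam_nil (h0 ▸ h2), h3,
        (List.take_append_drop _ _).symm, h1, h2⟩, ?_⟩
    rintro ⟨u, v⟩ ⟨h1, h2, h3, h4, h5, h6⟩
    simp only at h1 h2 h3 h4 h5 h6
    have h1 := List.length_pos_iff.2 h1
    have h2 := List.length_pos_iff.2 h2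
    have hl : u.length + v.length = n + 2 := by rw [← h, h4, List.length_append]
    have e := (hmem (u.length - 1)).1 (by
      rw [Nat.sub_add_cancel h1, h4, List.take_left, List.drop_left]
      exact ⟨by omega, h5, h6, h3⟩)
    rw [← e, Nat.sub_add_cancel h1, h4, List.take_left, List.drop_left]

theorem pairInd_take_drop {w u v : List Bool} {i : ℕ} (h : w = u ++ v) (hi : u.length = i) :
    pairInd (w.take i) (w.drop i) = pairInd u v := by
  rw [h, ← hi, List.take_left, List.drop_left]

theorem isUlam_replicate (n : ℕ) : IsUlam (List.replicate n false) ↔ n = 1 := by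
  induction n using Nat.strong_induction_on with
  | _ n ih =>
    rcases n with _ | _ | n
    · simp [not_isUlam_nil]
    · simpa using isUlam_of_length_eq_one [false] rfl
    · rw [isUlam_iff_sum _ n (by simp), Finset.sum_eq_zero]
      · simp
      · intro i hi
        rw [Finset.mem_range] at hi
        rw [pairInd_take_drop (u := List.replicate (i + 1) false)
          (v := List.replicate (n + 1 - i) false) (by rw [← List.replicate_add]; congr 1; omega)
          (by simp), pairInd, ih _ (by omega), ih _ (by omega), if_neg]
        rintro ⟨h1, h2, h3⟩
        exact h3 (by rw [h1, h2])

theorem pairInd_replicate_left (n : ℕ) (v : List Bool) (hn : n ≠ 1) :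
    pairInd (List.replicate n false) v = 0 := by
  rw [pairInd, isUlam_replicate, if_neg (fun h => hn h.1)]

theorem pairInd_replicate_right (n : ℕ) (u : List Bool) (hn : n ≠ 1) :
    pairInd u (List.replicate n false) = 0 := by
  rw [pairInd, isUlam_replicate, if_neg (fun h => hn h.2.1)]

open scoped Classical in
/-- The indicator of a word being Ulam. -/
noncomputable def ulamInd (w : List Bool) : ℕ := if IsUlam w then 1 else 0

theorem ulamInd_le_one (w : List Bool) : ulamInd w ≤ 1 := by
  rw [ulamInd]; split_ifs <;> simp

theorem ulamInd_eq_one (w : List Bool) : ulamInd w = 1 ↔ IsUlam w := by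
  rw [ulamInd]; split_ifs with h <;> simp [h]

theorem pairInd_singleton_left (v : List Bool) (h : true ∈ v) :
    pairInd [false] v = ulamInd v := by
  have h1 : [false] ≠ v := by rintro rfl; simp at h
  classical
  rw [pairInd, ulamInd]
  exact if_congr ⟨fun h => h.2.1, fun h => ⟨isUlam_of_length_eq_one _ rfl, h, h1⟩⟩ rfl rfl

theorem pairInd_singleton_right (u : List Bool) (h : true ∈ u) :
    pairInd u [false] = ulamInd u := by
  have h1 : u ≠ [false] := by rintro rfl; simp at h
  classical
  rw [pairInd, ulamInd]
  exact if_congr ⟨fun h => h.1, fun h => ⟨h, isUlam_of_length_eq_one _ rfl, h1⟩⟩ rfl rfl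

/-- Contribution of the splittings inside the leading block of zeros. -/
theorem sum_pairInd_leading (x : ℕ) (r : List Bool) (h : true ∈ r) :
    ∑ i ∈ Finset.range x, pairInd ((List.replicate x false ++ r).take (i + 1))
        ((List.replicate x false ++ r).drop (i + 1)) =
      if x = 0 then 0 else ulamInd (List.replicate (x - 1) false ++ r) := by
  rcases x with _ | x
  · simp
  · rw [Finset.sum_range_succ', Finset.sum_eq_zero, zero_add, if_neg (by omega),
      pairInd_take_drop (i := 0 + 1) (w := List.replicate (x + 1) false ++ r) (u := [false])
        (v := List.replicate x false ++ r) rfl rfl, pairInd_singleton_left _ (by simp [h])]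
    · rfl
    · intro i hi
      rw [Finset.mem_range] at hi
      rw [pairInd_take_drop (u := List.replicate (i + 1 + 1) false)
        (v := List.replicate (x - 1 - i) false ++ r) _ (by simp),
        pairInd_replicate_left _ _ (by omega)]
      rw [← List.append_assoc, ← List.replicate_add]
      congr 2
      omega

/-- Contribution of the splittings inside the trailing block of zeros. -/
theorem sum_pairInd_trailing (z n : ℕ) (l : List Bool) (h : true ∈ l) (hn : l.length = n) :
    ∑ i ∈ Finset.range z, pairInd ((l ++ List.replicate z false).take (n + i))
        ((l ++ List.replicate z false).drop (n + i)) =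
      if z = 0 then 0 else ulamInd (l ++ List.replicate (z - 1) false) := by
  rcases z with _ | z
  · simp
  · rw [Finset.sum_range_succ, Finset.sum_eq_zero, zero_add, if_neg (by omega),
      pairInd_take_drop (u := l ++ List.replicate z false) (v := [false])
        (by simp [List.replicate_succ']) (by simp [hn]), pairInd_singleton_right _ (by simp [h])]
    · rfl
    · intro i hi
      rw [Finset.mem_range] at hi
      rw [pairInd_take_drop (u := l ++ List.replicate i false)
        (v := List.replicate (z + 1 - i) false) _ (by simp [hn]),
        pairInd_replicate_right _ _ (by omega)]
      rw [List.append_assoc, ← List.replicate_add]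
      congr 2
      omega

theorem wordTwo_recursion (x z : ℕ) (h : x + z ≠ 0) :
    IsUlam (wordTwo x z) ↔ (if x = 0 then 0 else ulamInd (wordTwo (x - 1) z)) +
      (if z = 0 then 0 else ulamInd (wordTwo x (z - 1))) = 1 := by
  have h1 := sum_pairInd_leading x ([true] ++ List.replicate z false) (by simp)
  have h2 := sum_pairInd_trailing z (x + 1) (List.replicate x false ++ [true]) (by simp) (by simp)
  rw [isUlam_iff_sum (wordTwo x z) (x + z - 1) (by simp [wordTwo]; omega),
    show x + z - 1 + 1 = x + z by omega, Finset.sum_range_add]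
  simp only [← List.append_assoc] at h1
  simp only [add_right_comm x _ 1, wordTwo, h1, h2]

theorem isUlam_wordTwo (x z : ℕ) : IsUlam (wordTwo x z) ↔ x &&& z = 0 := by
  induction h : x + z using Nat.strong_induction_on generalizing x z with
  | _ n ih =>
    rcases Nat.eq_zero_or_pos n with rfl | hn
    · obtain rfl : x = 0 := by omega
      obtain rfl : z = 0 := by omega
      simpa using isUlam_of_length_eq_one _ rfl
    · rw [wordTwo_recursion x z (by omega)]
      rcases x with _ | x
      · have := ih _ (by omega) 0 (z - 1) rfl
        simp [show z ≠ 0 by omega, ulamInd, this]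
      · rcases z with _ | z
        · have := ih _ (by omega) x 0 rfl
          simp [ulamInd, this]
        · have h1 := ih _ (by omega) x (z + 1) rfl
          have h2 := ih _ (by omega) (x + 1) z rfl
          have h3 := land_eq_zero_iff_xor (x + 1) (z + 1) (by omega) (by omega)
          simp only [Nat.add_sub_cancel] at h3
          simp only [ulamInd, Nat.add_sub_cancel, h1, h2, h3]
          by_cases a : x &&& (z + 1) = 0 <;> by_cases b : (x + 1) &&& z = 0 <;> simp [a, b]

theorem wordTwo_inj {a b c d : ℕ} : wordTwo a b = wordTwo c d ↔ a = c ∧ b = d := by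
  constructor
  · intro h
    have h1 := congrArg List.length h
    have h2 := congrArg (fun l => l.idxOf true) h
    simp [wordTwo, List.idxOf_append] at h1 h2
    omega
  · rintro ⟨rfl, rfl⟩
    rfl

theorem sum_pairInd_wordTwo (y x z : ℕ) :
    ∑ a ∈ Finset.range (y + 1), pairInd (wordTwo x a) (wordTwo (y - a) z) =
      disjCount y x z - if x + z = y ∧ x &&& z = 0 then 1 else 0 := by
  suffices h : ∑ a ∈ Finset.range (y + 1), pairInd (wordTwo x a) (wordTwo (y - a) z) +
      (if x + z = y ∧ x &&& z = 0 then 1 else 0) = disjCount y x z by omega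
  have h : (if x + z = y ∧ x &&& z = 0 then 1 else 0) = ∑ a ∈ Finset.range (y + 1),
      if a = z then (if x + z = y ∧ x &&& z = 0 then 1 else 0) else 0 := by
    rw [Finset.sum_ite_eq']
    split_ifs with h1 h2 h2
    · rfl
    · simp only [Finset.mem_range] at h2; omega
    · rfl
    · rfl
  rw [h, ← Finset.sum_add_distrib, disjCount]
  refine Finset.sum_congr rfl fun a ha => ?_
  rw [Finset.mem_range] at ha
  simp only [pairInd, isUlam_wordTwo, ne_eq, wordTwo_inj, Nat.land_comm a x]
  by_cases h1 : a = z
  · subst h1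
    by_cases h2 : x + a = y
    · subst h2
      by_cases h3 : x &&& a = 0 <;> simp [h3]
    · simp [h2, show x ≠ y - a by omega]
  · simp [h1]

theorem wordThree_recursion (y x z : ℕ) :
    IsUlam (wordThree x y z) ↔ (if x = 0 then 0 else ulamInd (wordThree (x - 1) y z)) +
      (if z = 0 then 0 else ulamInd (wordThree x y (z - 1))) +
      (disjCount y x z - if x + z = y ∧ x &&& z = 0 then 1 else 0) = 1 := by
  have h1 := sum_pairInd_leading x
    ([true] ++ List.replicate y false ++ [true] ++ List.replicate z false) (by simp)
  have h2 := sum_pairInd_trailing z (x + (y + 1) + 1)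
    (List.replicate x false ++ [true] ++ List.replicate y false ++ [true]) (by simp)
    (by simp; omega)
  have h3 : ∑ a ∈ Finset.range (y + 1), pairInd ((wordThree x y z).take (x + a + 1))
      ((wordThree x y z).drop (x + a + 1)) =
        disjCount y x z - if x + z = y ∧ x &&& z = 0 then 1 else 0 := by
    rw [← sum_pairInd_wordTwo]
    refine Finset.sum_congr rfl fun a ha => ?_
    rw [Finset.mem_range] at ha
    refine pairInd_take_drop ?_ (by simp [wordTwo]; omega)
    obtain ⟨b, rfl⟩ : ∃ b, y = a + b := ⟨y - a, by omega⟩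
    simp only [wordTwo, wordThree, Nat.add_sub_cancel_left, List.replicate_add, List.append_assoc]
  rw [isUlam_iff_sum (wordThree x y z) (x + y + z) (by simp [wordThree]; omega),
    show x + y + z + 1 = x + (y + 1) + z by omega, Finset.sum_range_add, Finset.sum_range_add, h3]
  simp only [← List.append_assoc] at h1
  simp only [add_right_comm _ _ 1] at h2 ⊢
  simp only [wordThree, h1, h2]
  rw [add_right_comm]

/-- The generic behaviour of `0^x 1 0^y 1 0^z`. -/
def Regular (y x z : ℕ) : Prop :=
  IsUlam (wordThree x y z) ↔ (x + z) % 2 = 1 ∧ disjCount y x z = 1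

theorem ulamInd_eq_zero (w : List Bool) : ulamInd w = 0 ↔ ¬IsUlam w := by
  rw [ulamInd]; split_ifs with h <;> simp [h]

theorem wordThree_recursion_of_ne (y x z : ℕ) (h : ¬(x + z = y ∧ x &&& z = 0)) :
    IsUlam (wordThree x y z) ↔ (if x = 0 then 0 else ulamInd (wordThree (x - 1) y z)) +
      (if z = 0 then 0 else ulamInd (wordThree x y (z - 1))) + disjCount y x z = 1 := by
  rw [wordThree_recursion, if_neg h, Nat.sub_zero]

/-- When both neighbours fail to be Ulam, only the middle splittings count. -/
theorem isUlam_wordThree_iff_of_neighbors (y x z : ℕ)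
    (h : ∀ a b, a + b + 1 = x + z → ¬IsUlam (wordThree a y b)) :
    IsUlam (wordThree x y z) ↔
      (disjCount y x z - if x + z = y ∧ x &&& z = 0 then 1 else 0) = 1 := by
  have h1 : (if x = 0 then 0 else ulamInd (wordThree (x - 1) y z)) = 0 := by
    split_ifs with hx
    · rfl
    · exact (ulamInd_eq_zero _).2 (h _ _ (by omega))
  have h2 : (if z = 0 then 0 else ulamInd (wordThree x y (z - 1))) = 0 := by
    split_ifs with hz
    · rfl
    · exact (ulamInd_eq_zero _).2 (h _ _ (by omega))
  rw [wordThree_recursion, h1, h2, zero_add, zero_add]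

theorem two_le_disjCount_edge (y x z : ℕ) (hy : 0 < y) (h : x = 0 ∨ z = 0)
    (hp : (x + z) % 2 = 0) : 2 ≤ disjCount y x z := by
  rcases h with rfl | rfl
  · exact two_le_disjCount_zero_left y z hy (by omega)
  · rw [disjCount_comm]
    exact two_le_disjCount_zero_left y x hy (by omega)

theorem regular_of_two_le (y x z : ℕ) (h : ¬(x + z = y ∧ x &&& z = 0) ∨ 3 ≤ disjCount y x z)
    (h2 : 2 ≤ disjCount y x z) : Regular y x z := by
  have h3 : 2 ≤ disjCount y x z - if x + z = y ∧ x &&& z = 0 then 1 else 0 := by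
    split_ifs with hd
    · have := h.resolve_left (not_not.2 hd)
      omega
    · exact h2
  refine iff_of_false (fun hu => ?_) (fun hc => by omega)
  rw [wordThree_recursion] at hu
  omega

theorem regular_step (y x z : ℕ) (hy : 0 < y) (hreg : ∀ a b, a + b + 1 = x + z → Regular y a b)
    (h : ¬(x + z = y ∧ x &&& z = 0) ∨ 3 ≤ disjCount y x z) : Regular y x z := by
  by_cases h2 : 2 ≤ disjCount y x z
  · exact regular_of_two_le y x z h h2
  replace h := h.resolve_right (by omega)
  rcases Nat.mod_two_eq_zero_or_one (x + z) with hp | hp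
  · rcases x with _ | x
    · exact absurd (two_le_disjCount_edge y 0 z hy (Or.inl rfl) hp) h2
    rcases z with _ | z
    · exact absurd (two_le_disjCount_edge y _ 0 hy (Or.inr rfl) hp) h2
    refine iff_of_false (fun hu => ?_) (fun hc => by omega)
    have r1 := hreg x (z + 1) (by omega)
    have r2 := hreg (x + 1) z (by omega)
    rw [wordThree_recursion_of_ne _ _ _ h] at hu
    simp only [Nat.add_sub_cancel, Nat.add_eq_zero_iff, one_ne_zero, and_false, if_false] at hu
    rw [Regular, ← ulamInd_eq_one] at r1 r2
    have b1 := ulamInd_le_one (wordThree x y (z + 1))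
    have b2 := ulamInd_le_one (wordThree (x + 1) y z)
    rcases Nat.lt_or_ge 0 (disjCount y (x + 1) (z + 1)) with hc | hc
    · have := r1.2 ⟨by omega, disjCount_neighbor_eq_one y x z hy (by omega) (by omega)⟩
      omega
    · have he := disjCount_neighbors_eq y x z (by omega)
      have e1 : (x + (z + 1)) % 2 = 1 := by omega
      have e2 : (x + 1 + z) % 2 = 1 := by omega
      rw [he] at r1
      simp only [e1, e2, true_and] at r1 r2
      omega
  · rw [Regular, isUlam_wordThree_iff_of_neighbors, if_neg h, Nat.sub_zero]
    · simp [hp]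
    · intro a b hab hu
      have := ((hreg a b hab).1 hu).1
      omega

theorem regular_of_line (y n : ℕ) (hy : 0 < y) (hn : y < n)
    (hreg : ∀ a b, a + b = n → Regular y a b) (x z : ℕ) (h : n ≤ x + z) : Regular y x z := by
  induction hs : x + z using Nat.strong_induction_on generalizing x z with
  | _ s ih =>
    rcases h.eq_or_lt with h | h
    · exact hreg x z h.symm
    · exact regular_step y x z hy (fun a b hab => ih _ (by omega) a b (by omega) rfl)
        (Or.inl fun h0 => by omega)

theorem regular_of_lt (y x z : ℕ) (h : x + z < y) : Regular y x z := by
  induction hs : x + z using Nat.strong_induction_on generalizing x z with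
  | _ s ih =>
    exact regular_step y x z (by omega) (fun a b hab => ih _ (by omega) a b (by omega) rfl)
      (Or.inl fun h0 => by omega)

theorem regular_of_two_le_count (y x z : ℕ) (hy : 0 < y) (h : 2 ≤ (Nat.bits y).count false) :
    Regular y x z := by
  induction hs : x + z using Nat.strong_induction_on generalizing x z with
  | _ s ih =>
    refine regular_step y x z hy (fun a b hab => ih _ (by omega) a b rfl) ?_
    by_cases hd : x + z = y ∧ x &&& z = 0
    · obtain ⟨t, rfl⟩ : ∃ t, y = t + 1 := ⟨y - 1, by omega⟩
      right
      rw [(disjCount_of_land_eq_zero t x z hd.1 hd.2).1]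
      exact le_trans (by norm_num) (Nat.pow_le_pow_right (by norm_num) h)
    · exact Or.inl hd

theorem disjCount_ne_one (k y x z : ℕ) (h1 : 2 ^ k ≤ y) (h2 : y < 2 ^ (k + 1))
    (h : x + z + 1 < 2 ^ (k + 1)) : disjCount y x z ≠ 1 := fun hc => by
  have := two_pow_le_of_disjCount_eq_one k y x z h1 h2 hc
  omega

theorem bounds_of_disjCount_eq_one (k y x z : ℕ) (h1 : 2 ^ k ≤ y) (h2 : y < 2 ^ (k + 1))
    (h : disjCount y x z = 1) :
    2 ^ (k + 1) - 1 ≤ x % 2 ^ (k + 1) + z % 2 ^ (k + 1) ∧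
      x % 2 ^ (k + 1) + z % 2 ^ (k + 1) ≤ 2 ^ (k + 2) - y - 2 := by
  have hm := disjCount_mod (k + 1) y x z h2
  rw [h] at hm
  have hlo := two_pow_le_of_disjCount_eq_one k y _ _ h1 h2 hm
  have hup := add_le_of_disjCount_pos (k + 1) y _ _ h2 (Nat.mod_lt x (by positivity))
    (Nat.mod_lt z (by positivity)) (by omega)
  have : 2 ^ (k + 2) = 2 * 2 ^ (k + 1) := pow_succ' 2 (k + 1)
  omega

theorem count_false_bits_eq_zero_iff (k y : ℕ) (h1 : 2 ^ k ≤ y) (h2 : y < 2 ^ (k + 1)) :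
    (Nat.bits y).count false = 0 ↔ y + 1 = 2 ^ (k + 1) := by
  induction k generalizing y with
  | zero =>
    obtain rfl : y = 1 := by simp at h1 h2; omega
    simp
  | succ k ih =>
    have := pow_succ' 2 k
    have := pow_succ' 2 (k + 1)
    rcases Nat.even_or_odd' y with ⟨s, rfl | rfl⟩
    · rw [count_false_bits_two_mul s (by have := Nat.two_pow_pos k; omega)]
      omega
    · rw [count_false_bits_two_mul_add_one, ih s (by omega) (by omega)]
      omega

theorem not_isUlam_wordThree_of_lt (y x z : ℕ) (h : x + z < y) : ¬IsUlam (wordThree x y z) := by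
  intro hu
  have hc := ((regular_of_lt y x z h).1 hu).2
  have h1 := Nat.pow_log_le_self 2 (x := y) (by omega)
  have h2 := Nat.lt_pow_succ_log_self (b := 2) (by norm_num) y
  exact disjCount_ne_one _ y x z h1 h2 (by omega) hc

theorem isUlam_wordThree_iff_of_add_eq (y x z : ℕ) (h : x + z = y) :
    IsUlam (wordThree x y z) ↔ (disjCount y x z - if x &&& z = 0 then 1 else 0) = 1 := by
  rw [isUlam_wordThree_iff_of_neighbors _ _ _
    fun a b hab => not_isUlam_wordThree_of_lt y a b (by omega)]
  simp only [h, true_and]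

theorem isUlam_wordThree_iff_land_eq_zero (k y x z : ℕ) (h1 : 2 ^ k ≤ y) (h2 : y + 1 < 2 ^ (k + 1))
    (hcount : (Nat.bits y).count false = 1) (h : x + z = y) :
    IsUlam (wordThree x y z) ↔ x &&& z = 0 := by
  have := Nat.two_pow_pos k
  rw [isUlam_wordThree_iff_of_add_eq y x z h]
  split_ifs with hd
  · obtain ⟨t, rfl⟩ : ∃ t, y = t + 1 := ⟨y - 1, by omega⟩
    simp [(disjCount_of_land_eq_zero t x z h hd).1, hcount, hd]
  · simpa [hd] using disjCount_ne_one k y x z h1 (by omega) (by omega)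

theorem regular_of_count_eq_zero (k y x z : ℕ) (hy : y + 1 = 2 ^ (k + 1)) (h : y < x + z) :
    Regular y x z := by
  have := pow_succ' 2 k
  have := Nat.two_pow_pos k
  refine regular_of_line y (y + 1) (by omega) (by omega) (fun x z h => ?_) x z h
  by_cases h2 : 2 ≤ disjCount y x z
  · exact regular_of_two_le y x z (Or.inl fun h0 => by omega) h2
  refine iff_of_false (fun hu => ?_) (fun hc => by omega)
  rw [isUlam_wordThree_iff_of_neighbors, if_neg (fun h0 => by omega), Nat.sub_zero] at hu
  · rcases Nat.eq_zero_or_pos x with hx | hx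
    · exact h2 (two_le_disjCount_edge y x z (by omega) (Or.inl hx) (by omega))
    rcases Nat.eq_zero_or_pos z with hz | hz
    · exact h2 (two_le_disjCount_edge y x z (by omega) (Or.inr hz) (by omega))
    have := add_le_of_disjCount_pos (k + 1) y x z (by omega) (by omega) (by omega) (by omega)
    omega
  · intro a b hab
    have hd := land_eq_zero_of_add_eq_two_pow_sub_one (k + 1) a b (by omega)
    obtain ⟨t, rfl⟩ : ∃ t, y = t + 1 := ⟨y - 1, by omega⟩
    rw [isUlam_wordThree_iff_of_add_eq _ a b (by omega), if_pos hd,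
      (disjCount_of_land_eq_zero t a b (by omega) hd).1,
      (count_false_bits_eq_zero_iff k (t + 1) (by omega) (by omega)).2 hy]
    simp

theorem regular_of_count_eq_one_of_odd (k y x z : ℕ) (h1 : 2 ^ k ≤ y) (h2 : y + 2 < 2 ^ (k + 1))
    (hcount : (Nat.bits y).count false = 1) (hodd : y % 2 = 1) (h : y < x + z) :
    Regular y x z := by
  refine regular_of_line y (y + 1) (by omega) (by omega) (fun x z h => ?_) x z h
  by_cases hc2 : 2 ≤ disjCount y x z
  · exact regular_of_two_le y x z (Or.inl fun h0 => by omega) hc2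
  rcases x with _ | x
  · exact absurd (two_le_disjCount_edge y 0 z (by omega) (Or.inl rfl) (by omega)) hc2
  rcases z with _ | z
  · exact absurd (two_le_disjCount_edge y _ 0 (by omega) (Or.inr rfl) (by omega)) hc2
  have hc1 := disjCount_ne_one k y (x + 1) (z + 1) h1 (by omega) (by omega)
  refine iff_of_false (fun hu => ?_) (fun hc => hc1 hc.2)
  rw [wordThree_recursion_of_ne _ _ _ (fun h0 => by omega)] at hu
  have r1 := isUlam_wordThree_iff_land_eq_zero k y x (z + 1) h1 (by omega) hcount (by omega)
  have r2 := isUlam_wordThree_iff_land_eq_zero k y (x + 1) z h1 (by omega) hcount (by omega)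
  have hxor := land_eq_zero_iff_xor (x + 1) (z + 1) (by omega) (by omega)
  rw [← ulamInd_eq_one] at r1 r2
  simp only [Nat.add_sub_cancel, Nat.add_eq_zero_iff, one_ne_zero, and_false, if_false] at hu hxor
  rw [← r1, ← r2] at hxor
  have b1 := ulamInd_le_one (wordThree x y (z + 1))
  have b2 := ulamInd_le_one (wordThree (x + 1) y z)
  by_cases hd : (x + 1) &&& (z + 1) = 0
  · have hn1 : ulamInd (wordThree x y (z + 1)) ≠ 1 := fun h0 => by
      have := (disjCount_pos_iff y (x + 1) (z + 1)).2
        ⟨z + 1, x, by omega, by rw [Nat.land_comm, hd], r1.1 h0⟩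
      omega
    have hn2 : ulamInd (wordThree (x + 1) y z) ≠ 1 := fun h0 => by
      have := (disjCount_pos_iff y (x + 1) (z + 1)).2
        ⟨z, x + 1, by omega, by rw [Nat.land_comm, r2.1 h0], hd⟩
      omega
    omega
  · have := not_iff_not.2 hxor
    simp only [hd, not_not, not_false_eq_true, true_iff] at this
    omega

theorem disjCount_eq_one_of_add_eq_two_pow (k y x z : ℕ) (hy : y + 2 = 2 ^ (k + 1)) (hx : 0 < x)
    (hz : 0 < z) (h : x + z = 2 ^ (k + 1)) : disjCount y x z = 1 := by
  have hpos : 0 < disjCount y x z := (disjCount_pos_iff y x z).2 ⟨z - 1, x - 1, by omega,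
    land_eq_zero_of_add_eq_two_pow_sub_one (k + 1) _ _ (by omega),
    land_eq_zero_of_add_eq_two_pow_sub_one (k + 1) _ _ (by omega)⟩
  refine le_antisymm ?_ hpos
  rw [disjCount, Finset.sum_boole, Nat.cast_id, Finset.card_le_one]
  have key : ∀ a ∈ (Finset.range (y + 1)).filter fun a => a &&& x = 0 ∧ (y - a) &&& z = 0,
      a = z - 1 := by
    intro a ha
    rw [Finset.mem_filter, Finset.mem_range] at ha
    have h1 := add_lt_two_pow_of_land_eq_zero (k + 1) a x (by omega) (by omega) ha.2.1
    have h2 := add_lt_two_pow_of_land_eq_zero (k + 1) (y - a) z (by omega) (by omega) ha.2.2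
    omega
  intro a ha b hb
  rw [key a ha, key b hb]

theorem not_isUlam_wordThree_of_add_eq_succ (k y x z : ℕ) (hk : 0 < k) (hy : y + 2 = 2 ^ (k + 1))
    (h : x + z = y + 1) : ¬IsUlam (wordThree x y z) := by
  have hp := pow_succ' 2 k
  have hk2 := Nat.pow_le_pow_right (n := 2) (by norm_num) (show 1 ≤ k by omega)
  have hy2 : y = 2 * (2 ^ k - 1) := by omega
  have hcount : (Nat.bits y).count false = 1 := by
    obtain ⟨j, rfl⟩ : ∃ j, k = j + 1 := ⟨k - 1, by omega⟩
    have := pow_succ' 2 j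
    rw [hy2, count_false_bits_two_mul _ (by omega),
      (count_false_bits_eq_zero_iff j _ (by omega) (by omega)).2 (by omega)]
  have hcount' : (Nat.bits (y + 1)).count false = 0 :=
    (count_false_bits_eq_zero_iff k _ (by omega) (by omega)).2 (by omega)
  have hd := land_eq_zero_of_add_eq_two_pow_sub_one (k + 1) x z (by omega)
  have hc := (disjCount_of_land_eq_zero y x z h hd).2
  rw [hcount', pow_zero] at hc
  have key : ∀ a b, a + b = y → a % 2 = 0 → ulamInd (wordThree a y b) = 1 := by
    intro a b hab ha
    have hd' := land_eq_zero_of_add_eq_two_pow_sub_one (k + 1) (a + 1) b (by omega)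
    rw [ulamInd_eq_one, isUlam_wordThree_iff_land_eq_zero k y a b (by omega) (by omega) hcount hab,
      land_eq_zero_iff_half]
    rw [land_eq_zero_iff_half, show (a + 1) / 2 = a / 2 by omega] at hd'
    exact ⟨by omega, hd'.2⟩
  rw [wordThree_recursion_of_ne _ _ _ (fun h0 => by omega), hc]
  rcases Nat.mod_two_eq_zero_or_one x with hx | hx
  · have := key x (z - 1) (by omega) hx
    simp only [show z ≠ 0 by omega, if_false, this]
    omega
  · have := key (x - 1) z (by omega) (by omega)
    simp only [show x ≠ 0 by omega, if_false, this]
    omega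

theorem isUlam_wordThree_iff_of_add_eq_two_pow (k y x z : ℕ) (hk : 0 < k)
    (hy : y + 2 = 2 ^ (k + 1)) (h : x + z = 2 ^ (k + 1)) :
    IsUlam (wordThree x y z) ↔ 0 < x ∧ 0 < z := by
  have hp := pow_succ' 2 k
  have hk2 := Nat.pow_le_pow_right (n := 2) (by norm_num) (show 1 ≤ k by omega)
  rw [isUlam_wordThree_iff_of_neighbors _ _ _
    fun a b hab => not_isUlam_wordThree_of_add_eq_succ k y a b hk hy (by omega),
    if_neg (fun h0 => by omega), Nat.sub_zero]
  by_cases hxz : 0 < x ∧ 0 < z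
  · simp [disjCount_eq_one_of_add_eq_two_pow k y x z hy hxz.1 hxz.2 h, hxz]
  · have := two_le_disjCount_edge y x z (by omega) (by omega) (by omega)
    simp only [hxz, iff_false]
    omega

theorem two_le_disjCount_one_two_pow (k y : ℕ) (hk : 0 < k) (hy : y + 2 = 2 ^ (k + 1)) :
    2 ≤ disjCount y 1 (2 ^ (k + 1)) := by
  have hp := pow_succ' 2 k
  have hk2 := Nat.pow_le_pow_right (n := 2) (by norm_num) (show 1 ≤ k by omega)
  rw [← disjCount_mod (k + 1) y _ _ (by omega), Nat.mod_self,
    Nat.mod_eq_of_lt (by omega : 1 < 2 ^ (k + 1))]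
  obtain ⟨s, rfl⟩ : ∃ s, y = 2 * s + 2 := ⟨2 ^ k - 2, by omega⟩
  rw [disjCount_two_mul_add_two]
  simpa using two_le_disjCount_zero_left (s + 1) 0 (by omega) rfl

theorem regular_of_add_two_eq_two_pow (k y x z : ℕ) (hk : 0 < k) (hy : y + 2 = 2 ^ (k + 1))
    (h : y + 2 < x + z) : Regular y x z := by
  have hp := pow_succ' 2 k
  have hk2 := Nat.pow_le_pow_right (n := 2) (by norm_num) (show 1 ≤ k by omega)
  refine regular_of_line y (y + 3) (by omega) (by omega) (fun x z h => ?_) x z h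
  have hne : ¬(x + z = y ∧ x &&& z = 0) := fun h0 => by omega
  by_cases hc2 : 2 ≤ disjCount y x z
  · exact regular_of_two_le y x z (Or.inl hne) hc2
  have key := isUlam_wordThree_iff_of_add_eq_two_pow k y
  by_cases h0 : x = 0 ∨ z = 0
  · rw [Regular, wordThree_recursion_of_ne _ _ _ hne]
    have e1 : (if x = 0 then 0 else ulamInd (wordThree (x - 1) y z)) = 0 := by
      split_ifs with hx
      · rfl
      · rw [ulamInd_eq_zero, key (x - 1) z hk hy (by omega)]
        omega
    have e2 : (if z = 0 then 0 else ulamInd (wordThree x y (z - 1))) = 0 := by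
      split_ifs with hz
      · rfl
      · rw [ulamInd_eq_zero, key x (z - 1) hk hy (by omega)]
        omega
    simp only [e1, e2, zero_add, show (x + z) % 2 = 1 by omega, true_and]
  have hx : x ≠ 1 := by
    rintro rfl
    obtain rfl : z = 2 ^ (k + 1) := by omega
    exact hc2 (two_le_disjCount_one_two_pow k y hk hy)
  have hz : z ≠ 1 := by
    rintro rfl
    obtain rfl : x = 2 ^ (k + 1) := by omega
    exact hc2 (disjCount_comm y _ _ ▸ two_le_disjCount_one_two_pow k y hk hy)
  have e1 := (ulamInd_eq_one _).2 ((key (x - 1) z hk hy (by omega)).2 (by omega))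
  have e2 := (ulamInd_eq_one _).2 ((key x (z - 1) hk hy (by omega)).2 (by omega))
  refine iff_of_false (fun hu => ?_) (fun hc => ?_)
  · rw [wordThree_recursion_of_ne _ _ _ hne, e1, e2, if_neg (by omega), if_neg (by omega)] at hu
    omega
  · have := add_le_of_disjCount_pos (k + 1) y x z (by omega) (by omega) (by omega) (by omega)
    omega

theorem regular_of_isZumkeller (k y x z : ℕ) (h1 : 2 ^ k ≤ y) (h2 : y < 2 ^ (k + 1))
    (hy : IsZumkeller y) (h0 : x + z ≠ y) (h3 : x + z ≠ y + 1) (h4 : x + z ≠ y + 2) :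
    Regular y x z := by
  rcases Nat.lt_or_ge (x + z) y with hlt | hge
  · exact regular_of_lt y x z hlt
  have hiff := count_false_bits_eq_zero_iff k y h1 h2
  by_cases hcount : (Nat.bits y).count false = 0
  · exact regular_of_count_eq_zero k y x z (hiff.1 hcount) (by omega)
  have hne : y + 1 ≠ 2 ^ (k + 1) := fun h => hcount (hiff.2 h)
  have hone : (Nat.bits y).count false = 1 := by
    have := hy.2
    omega
  have hp := pow_succ' 2 k
  rcases Nat.even_or_odd' y with ⟨s, rfl | rfl⟩
  · rcases k with _ | j
    · omega
    have hp' := pow_succ' 2 j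
    rw [count_false_bits_two_mul s (by omega), Nat.add_eq_right,
      count_false_bits_eq_zero_iff j s (by omega) (by omega)] at hone
    exact regular_of_add_two_eq_two_pow (j + 1) _ x z (by omega) (by omega) (by omega)
  · exact regular_of_count_eq_one_of_odd k _ x z h1 (by omega) hone (by omega) (by omega)

/-- bounds `2^(k+1)-1 ≤ x̃+z̃ ≤ 2^(k+2)-y-2` on members of `Ulam[y]`,
where `x̃, z̃` are the reductions mod `2^(k+1)`. -/
theorem ulamSet_sum_bounds (k y : ℕ) (h1 : 2 ^ k ≤ y) (h2 : y < 2 ^ (k + 1))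
    (x z : ℕ) (h : (x, z) ∈ UlamSet y) :
    (¬ IsZumkeller y →
      2 ^ (k + 1) - 1 ≤ x % 2 ^ (k + 1) + z % 2 ^ (k + 1) ∧
      x % 2 ^ (k + 1) + z % 2 ^ (k + 1) ≤ 2 ^ (k + 2) - y - 2) ∧
    (IsZumkeller y → x + z ≠ y → x + z ≠ y + 1 → x + z ≠ y + 2 →
      2 ^ (k + 1) - 1 ≤ x % 2 ^ (k + 1) + z % 2 ^ (k + 1) ∧
      x % 2 ^ (k + 1) + z % 2 ^ (k + 1) ≤ 2 ^ (k + 2) - y - 2) := by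
  change IsUlam (wordThree x y z) at h
  have hy : 0 < y := lt_of_lt_of_le (Nat.two_pow_pos k) h1
  refine ⟨fun hnz => ?_, fun hz h0 h3 h4 => ?_⟩
  · refine bounds_of_disjCount_eq_one k y x z h1 h2
      ((regular_of_two_le_count y x z hy ?_).1 h).2
    by_contra hc
    exact hnz ⟨hy, by omega⟩
  · exact bounds_of_disjCount_eq_one k y x z h1 h2
      ((regular_of_isZumkeller k y x z h1 h2 hz h0 h3 h4).1 h).2
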